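/- arXiv:2011.01770 — 3 statements merged into one kernel-verified Lean document; each statement's English description precedes it below -/
import Mathlib

section
/- Let P_n be the path graph on vertices {1,…,n} (with i adjacent to i+1 for 1 ≤ i < n), and let V_1, …, V_m be a partition of {1,…,n} into m sets each of odd size. Then there exist two disjoint independent sets S_1 and S_2 of P_n such that |S_1 ∪ S_2| ≥ n − m and such that for every i ∈ {1,…,m} it holds that |S_1 ∩ V_i| = (|V_i| − 1)/2 (equivalently, |V_i|/2 − 1 ≤ |S_1 ∩ V_i| ≤ |V_i|/2). -/
/-- A subset of the vertex set `{1, …, n}` of the path `P_n` is independent if it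
contains no two consecutive integers. -/
def PathIndepSet (S : Finset ℕ) : Prop :=
  ∀ v ∈ S, v + 1 ∉ S

/-- The indicator modulo 2 of the property that a word of signs alternates, starting with `b`. -/
def altSign : Bool → List Bool → ZMod 2
  | _, [] => 1
  | b, a :: t => if a = b then altSign (!b) t else 0

theorem altSign_map_not (b : Bool) (l : List Bool) :
    altSign b (l.map not) = altSign (!b) l := by
  induction l generalizing b with
  | nil => rfl
  | cons a t ih => cases a <;> cases b <;> simp [altSign, ih]

theorem exists_eq_cons_of_pairwise_le {α : Type*} [LinearOrder α] {x : α} {t : List α}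
    (h : (x :: t).Pairwise (· ≤ ·)) (hx : x ∈ t) : ∃ u, t = x :: u := by
  rw [List.pairwise_cons] at h
  cases t with
  | nil => simp at hx
  | cons y u =>
    refine ⟨u, ?_⟩
    rw [le_antisymm _ (h.1 y (by simp))]
    rcases List.mem_cons.1 hx with hy | hu
    · exact hy.ge
    · exact (List.pairwise_cons.1 h.2).1 x hu

theorem sum_altSign_erase {α : Type*} [LinearOrder α] (sgn : α → Bool) (b : Bool) (l : List α)
    (hl : l.Pairwise (· ≤ ·)) :
    (l.map fun a => altSign b ((l.erase a).map sgn)).sum =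
      altSign true (l.map sgn) + altSign false (l.map sgn) := by
  induction l generalizing b with
  | nil => exact (CharTwo.add_self_eq_zero (1 : ZMod 2)).symm
  | cons x t ih =>
    have herase : ∀ a ∈ t, (x :: t).erase a = x :: t.erase a := by
      intro a ha
      by_cases hxa : x = a
      · subst hxa
        obtain ⟨u, rfl⟩ := exists_eq_cons_of_pairwise_le hl ha
        simp
      · rw [List.erase_cons_tail (by simpa using hxa)]
    have htail : (t.map fun a => altSign b (((x :: t).erase a).map sgn)) =
        t.map fun a => if sgn x = b then altSign (!b) ((t.erase a).map sgn) else 0 := by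
      apply List.map_congr_left
      intro a ha
      rw [herase a ha]
      simp [altSign]
    rw [List.map_cons, List.sum_cons, htail]
    have ih' := ih (!b) (List.pairwise_cons.1 hl).2
    have hself := fun z : ZMod 2 => CharTwo.add_self_eq_zero z
    simp only [List.erase_cons_head, List.map_cons, altSign]
    by_cases hb : sgn x = b
    · simp only [hb, if_true]
      rw [ih']
      cases b
      · simp [add_comm]
        grind
      · simp [← add_assoc, hself]
    · cases b <;> simp_all

theorem pairwise_lt_of_altSign_ne_zero {α : Type*} [LinearOrder α] (sgn : α → Bool) (b : Bool)
    (l : List α) (hl : l.Pairwise (· ≤ ·)) (h : altSign b (l.map sgn) ≠ 0) :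
    l.Pairwise (· < ·) := by
  induction l generalizing b with
  | nil => simp
  | cons x t ih =>
    have hx : sgn x = b ∧ altSign (!b) (t.map sgn) ≠ 0 := by
      by_cases hb : sgn x = b <;> simp_all [altSign]
    have hl' := List.pairwise_cons.1 hl
    refine List.pairwise_cons.2 ⟨fun a ha => lt_of_le_of_ne (hl'.1 a ha) ?_, ih (!b) hl'.2 hx.2⟩
    rintro rfl
    obtain ⟨u, rfl⟩ := exists_eq_cons_of_pairwise_le hl ha
    simpa [altSign, hx.1] using hx.2

theorem sum_altSign_sort_erase {α : Type*} [LinearOrder α] (sgn : α → Bool) (b : Bool)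
    (M : Multiset α) :
    (M.map fun a => altSign b (((M.erase a).sort (· ≤ ·)).map sgn)).sum =
      altSign true ((M.sort (· ≤ ·)).map sgn) + altSign false ((M.sort (· ≤ ·)).map sgn) := by
  rw [← sum_altSign_erase sgn b (M.sort (· ≤ ·)) (M.pairwise_sort _), ← Multiset.sum_coe,
    ← Multiset.map_coe, Multiset.sort_eq]
  congr 1
  apply Multiset.map_congr rfl
  intro a _
  congr 2
  refine List.Perm.eq_of_pairwise' (r := (· ≤ ·)) (Multiset.pairwise_sort _ _) ?_ ?_
  · exact (M.pairwise_sort _).sublist List.erase_sublist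
  · rw [← Multiset.coe_eq_coe, Multiset.sort_eq, ← Multiset.coe_erase, Multiset.sort_eq]

/-- The indicator modulo 2 of the property that the signs of a multiset of signed labels, ordered
by absolute value, alternate, starting with `b`. -/
def altInd (b : Bool) (M : Multiset (ℕ ×ₗ Bool)) : ZMod 2 :=
  altSign b ((M.sort (· ≤ ·)).map fun a => (ofLex a).2)

theorem sum_altInd_erase (b : Bool) (M : Multiset (ℕ ×ₗ Bool)) :
    (M.map fun a => altInd b (M.erase a)).sum = altInd true M + altInd false M := by
  rw [altInd, altInd, ← sum_altSign_sort_erase _ b]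
  congr! 4

theorem nodup_of_altInd_ne_zero (b : Bool) (M : Multiset (ℕ ×ₗ Bool)) (h : altInd b M ≠ 0) :
    M.Nodup := by
  rw [← M.sort_eq (· ≤ ·), Multiset.coe_nodup]
  exact (pairwise_lt_of_altSign_ne_zero _ b _ (M.pairwise_sort _) h).imp ne_of_lt

/-- The signed label with the same absolute value and the opposite sign. -/
def flipSign (a : ℕ ×ₗ Bool) : ℕ ×ₗ Bool := toLex ((ofLex a).1, !(ofLex a).2)

theorem altInd_map_flipSign (b : Bool) (M : Multiset (ℕ ×ₗ Bool))
    (h : ∀ x ∈ M, ∀ y ∈ M, (ofLex x).1 = (ofLex y).1 → (ofLex x).2 = (ofLex y).2) :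
    altInd b (M.map flipSign) = altInd (!b) M := by
  have hsort : (M.sort (· ≤ ·)).map flipSign = (M.map flipSign).sort (· ≤ ·) := by
    apply Multiset.map_sort
    intro x hx y hy
    have := h x hx y hy
    simp only [Prod.Lex.le_iff, flipSign, ofLex_toLex]
    grind
  rw [altInd, altInd, ← altSign_map_not, ← hsort, List.map_map, List.map_map]
  rfl

section Tucker

variable {n : ℕ}

/-- The coordinates of sign `b` in the `r`-th vertex of the flag of signed sets in which the
element `i` is added at time `F.1 i` with sign `F.2 i`. -/
def flagPart (F : Equiv.Perm (Fin n) × (Fin n → Bool)) (b : Bool) (r : ℕ) : Finset (Fin n) :=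
  Finset.univ.filter fun i => (F.1 i : ℕ) ≤ r ∧ F.2 i = b

theorem mem_flagPart {F : Equiv.Perm (Fin n) × (Fin n → Bool)} {b : Bool} {r : ℕ} {i : Fin n} :
    i ∈ flagPart F b r ↔ (F.1 i : ℕ) ≤ r ∧ F.2 i = b := by
  simp [flagPart]

/-- The multiset of labels of the vertices of a flag with indices in `R`. -/
def flagLabels (lab : Finset (Fin n) → Finset (Fin n) → ℕ ×ₗ Bool)
    (F : Equiv.Perm (Fin n) × (Fin n → Bool)) (R : Finset ℕ) : Multiset (ℕ ×ₗ Bool) :=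
  R.val.map fun r => lab (flagPart F true r) (flagPart F false r)

/-- The flags of the upper hemisphere of the `j`-dimensional cross-polytope. -/
def hemisphere (n j : ℕ) : Finset (Equiv.Perm (Fin n) × (Fin n → Bool)) :=
  Finset.univ.filter fun F =>
    (∀ i : Fin n, j < (i : ℕ) → F.1 i = i) ∧ ∀ i : Fin n, j ≤ (i : ℕ) → F.2 i = true

theorem flagLabels_congr (lab : Finset (Fin n) → Finset (Fin n) → ℕ ×ₗ Bool)
    {F G : Equiv.Perm (Fin n) × (Fin n → Bool)} {R : Finset ℕ}
    (h : ∀ r ∈ R, ∀ b, flagPart F b r = flagPart G b r) :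
    flagLabels lab F R = flagLabels lab G R := by
  apply Multiset.map_congr rfl
  intro r hr
  rw [h r hr, h r hr]

theorem sum_altInd_flagLabels_erase (lab : Finset (Fin n) → Finset (Fin n) → ℕ ×ₗ Bool)
    (F : Equiv.Perm (Fin n) × (Fin n → Bool)) (b : Bool) (R : Finset ℕ) :
    ∑ r ∈ R, altInd b (flagLabels lab F (R.erase r)) =
      altInd true (flagLabels lab F R) + altInd false (flagLabels lab F R) := by
  rw [← sum_altInd_erase b, flagLabels, Multiset.map_map, Finset.sum]
  congr 1
  apply Multiset.map_congr rfl
  intro r hr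
  rw [flagLabels, Finset.erase_val, Function.comp_apply, Multiset.map_erase_of_mem _ _ hr]

theorem flagPart_swap (F : Equiv.Perm (Fin n) × (Fin n → Bool)) (b : Bool) {r q : ℕ}
    (hr : r + 1 < n) (hq : q ≠ r) :
    flagPart (Equiv.swap ⟨r, by omega⟩ ⟨r + 1, hr⟩ * F.1, F.2) b q = flagPart F b q := by
  ext i
  rw [mem_flagPart, mem_flagPart, Equiv.Perm.mul_apply]
  refine and_congr ?_ Iff.rfl
  by_cases h1 : F.1 i = ⟨r, by omega⟩
  · rw [h1, Equiv.swap_apply_left]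
    simp only
    omega
  · by_cases h2 : F.1 i = ⟨r + 1, hr⟩
    · rw [h2, Equiv.swap_apply_right]
      simp only
      omega
    · rw [Equiv.swap_apply_of_ne_of_ne h1 h2]

theorem sum_hemisphere_erase_of_lt (lab : Finset (Fin n) → Finset (Fin n) → ℕ ×ₗ Bool) (b : Bool)
    {j r : ℕ} (hj : j < n) (hr : r < j) :
    ∑ F ∈ hemisphere n j, altInd b (flagLabels lab F ((Finset.range (j + 1)).erase r)) = 0 := by
  have hrn : r + 1 < n := by omega
  apply Finset.sum_involution
    (fun F _ => (Equiv.swap ⟨r, by omega⟩ ⟨r + 1, hrn⟩ * F.1, F.2))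
  · intro F _
    rw [flagLabels_congr lab (F := (_, _)) (G := F)
      fun q hq b => flagPart_swap F b hrn (Finset.ne_of_mem_erase hq)]
    exact CharTwo.add_self_eq_zero _
  · intro F _ _ h
    have h1 := (mul_eq_right (a := Equiv.swap (⟨r, by omega⟩ : Fin n) ⟨r + 1, hrn⟩)).1
      (congrArg Prod.fst h)
    rw [Equiv.swap_eq_one_iff, Fin.mk.injEq] at h1
    omega
  · intro F _
    simp [← mul_assoc]
  · intro F hF
    simp only [hemisphere, Finset.mem_filter, Finset.mem_univ, true_and,
      Equiv.Perm.mul_apply] at hF ⊢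
    refine ⟨fun i hi => ?_, hF.2⟩
    rw [hF.1 i hi, Equiv.swap_apply_of_ne_of_ne] <;> rw [Ne, Fin.ext_iff] <;> simp only <;> omega

theorem flagPart_update (F : Equiv.Perm (Fin n) × (Fin n → Bool)) (b c : Bool) {i : Fin n} {q : ℕ}
    (hq : q < F.1 i) :
    flagPart (F.1, Function.update F.2 i c) b q = flagPart F b q := by
  ext k
  rw [mem_flagPart, mem_flagPart]
  refine and_congr_right fun hk => ?_
  change Function.update F.2 i c k = b ↔ _
  rw [Function.update_of_ne]
  rintro rfl
  exact hq.not_ge hk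

theorem sum_hemisphere_filter_ne (lab : Finset (Fin n) → Finset (Fin n) → ℕ ×ₗ Bool) (b : Bool)
    {j : ℕ} (hj : j < n) :
    ∑ F ∈ (hemisphere n j).filter (fun F => F.1 ⟨j, hj⟩ ≠ ⟨j, hj⟩),
      altInd b (flagLabels lab F (Finset.range j)) = 0 := by
  apply Finset.sum_involution (fun F _ => (F.1, Function.update F.2 (F.1.symm ⟨j, hj⟩)
    (!F.2 (F.1.symm ⟨j, hj⟩))))
  · intro F _
    rw [flagLabels_congr lab (G := F) fun q hq b => flagPart_update F b _ (by simpa using hq)]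
    exact CharTwo.add_self_eq_zero _
  · intro F _ _ h
    have := congrFun (congrArg Prod.snd h) (F.1.symm ⟨j, hj⟩)
    simp at this
  · intro F _
    simp
  · intro F hF
    simp only [hemisphere, Finset.mem_filter, Finset.mem_univ, true_and] at hF ⊢
    refine ⟨⟨hF.1.1, fun i hi => ?_⟩, hF.2⟩
    rw [Function.update_of_ne, hF.1.2 i hi]
    rintro rfl
    rcases hi.eq_or_lt with h | h
    · have : F.1.symm ⟨j, hj⟩ = ⟨j, hj⟩ := Fin.ext h.symm
      rw [Equiv.symm_apply_eq] at this
      exact hF.2 this.symm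
    · have := hF.1.1 _ h
      rw [Equiv.apply_symm_apply] at this
      rw [← this] at h
      simp at h

theorem disjoint_flagPart (F : Equiv.Perm (Fin n) × (Fin n → Bool)) (r s : ℕ) :
    Disjoint (flagPart F true r) (flagPart F false s) := by
  rw [Finset.disjoint_left]
  intro i hi hi'
  rw [mem_flagPart] at hi hi'
  simp [hi.2] at hi'

theorem flagPart_mono (F : Equiv.Perm (Fin n) × (Fin n → Bool)) (b : Bool) {r s : ℕ} (h : r ≤ s) :
    flagPart F b r ⊆ flagPart F b s := by
  intro i hi
  rw [mem_flagPart] at hi ⊢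
  exact ⟨hi.1.trans h, hi.2⟩

theorem flagPart_union_nonempty (F : Equiv.Perm (Fin n) × (Fin n → Bool)) {r : ℕ} (h : r < n) :
    (flagPart F true r ∪ flagPart F false r).Nonempty := by
  refine ⟨F.1.symm ⟨r, h⟩, ?_⟩
  simp only [Finset.mem_union, mem_flagPart]
  cases F.2 (F.1.symm ⟨r, h⟩) <;> simp

/-- An antipodal labelling of the signed subsets of `Fin n` by signed labels without complementary
comparable pairs. -/
structure IsTuckerLabelling (lab : Finset (Fin n) → Finset (Fin n) → ℕ ×ₗ Bool) : Prop where
  antipodal : ∀ A B, Disjoint A B → (A ∪ B).Nonempty → lab B A = flipSign (lab A B)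
  noncompl : ∀ A B A' B', Disjoint A' B' → (A ∪ B).Nonempty → A ⊆ A' → B ⊆ B' →
    (ofLex (lab A B)).1 = (ofLex (lab A' B')).1 → (ofLex (lab A B)).2 = (ofLex (lab A' B')).2

variable {lab : Finset (Fin n) → Finset (Fin n) → ℕ ×ₗ Bool}

theorem IsTuckerLabelling.sign_eq_of_flag (hlab : IsTuckerLabelling lab)
    (F : Equiv.Perm (Fin n) × (Fin n → Bool)) {r s : ℕ} (hr : r < n) (hs : s < n)
    (h : (ofLex (lab (flagPart F true r) (flagPart F false r))).1 =
      (ofLex (lab (flagPart F true s) (flagPart F false s))).1) :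
    (ofLex (lab (flagPart F true r) (flagPart F false r))).2 =
      (ofLex (lab (flagPart F true s) (flagPart F false s))).2 := by
  rcases le_total r s with hrs | hrs
  · exact hlab.noncompl _ _ _ _ (disjoint_flagPart F s s) (flagPart_union_nonempty F hr)
      (flagPart_mono F _ hrs) (flagPart_mono F _ hrs) h
  · exact (hlab.noncompl _ _ _ _ (disjoint_flagPart F r r) (flagPart_union_nonempty F hs)
      (flagPart_mono F _ hrs) (flagPart_mono F _ hrs) h.symm).symm

/-- The flag with the signs of the first `j` coordinates reversed. -/
def flipFlag (j : ℕ) (F : Equiv.Perm (Fin n) × (Fin n → Bool)) :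
    Equiv.Perm (Fin n) × (Fin n → Bool) :=
  (F.1, fun i => if (i : ℕ) < j then !F.2 i else F.2 i)

theorem flipFlag_flipFlag (j : ℕ) (F : Equiv.Perm (Fin n) × (Fin n → Bool)) :
    flipFlag j (flipFlag j F) = F := by
  refine Prod.ext rfl (funext fun i => ?_)
  by_cases h : (i : ℕ) < j <;> simp [flipFlag, h]

theorem IsTuckerLabelling.altInd_flipFlag (hlab : IsTuckerLabelling lab) {j : ℕ} (hj : j ≤ n)
    {F : Equiv.Perm (Fin n) × (Fin n → Bool)} (hF : ∀ i : Fin n, j ≤ (i : ℕ) → F.1 i = i)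
    (b : Bool) :
    altInd b (flagLabels lab (flipFlag j F) (Finset.range j)) =
      altInd (!b) (flagLabels lab F (Finset.range j)) := by
  have hpart : ∀ r ∈ Finset.range j, ∀ c, flagPart (flipFlag j F) c r = flagPart F (!c) r := by
    intro r hr c
    ext i
    rw [mem_flagPart, mem_flagPart]
    refine and_congr_right fun hi => ?_
    have hij : (i : ℕ) < j := by
      by_contra hij
      have hi' : (F.1 i : ℕ) ≤ r := hi
      rw [hF i (by omega)] at hi'
      rw [Finset.mem_range] at hr
      omega
    cases c <;> simp [flipFlag, hij]
  rw [← altInd_map_flipSign]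
  · congr 1
    rw [flagLabels, flagLabels, Multiset.map_map]
    apply Multiset.map_congr rfl
    intro r hr
    rw [hpart r hr, hpart r hr]
    exact hlab.antipodal _ _ (disjoint_flagPart F r r)
      (flagPart_union_nonempty F ((Finset.mem_range.1 hr).trans_le hj))
  · intro x hx y hy
    obtain ⟨r, hr, rfl⟩ := Multiset.mem_map.1 hx
    obtain ⟨s, hs, rfl⟩ := Multiset.mem_map.1 hy
    exact hlab.sign_eq_of_flag F ((Finset.mem_range.1 hr).trans_le hj)
      ((Finset.mem_range.1 hs).trans_le hj)

theorem IsTuckerLabelling.sum_hemisphere_filter_eq (hlab : IsTuckerLabelling lab) (b : Bool)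
    {j : ℕ} (hj : j + 1 < n) :
    ∑ F ∈ (hemisphere n (j + 1)).filter (fun F => F.1 ⟨j + 1, hj⟩ = ⟨j + 1, hj⟩),
      altInd b (flagLabels lab F (Finset.range (j + 1))) =
    ∑ F ∈ hemisphere n j, altInd b (flagLabels lab F (Finset.range (j + 1))) +
      ∑ F ∈ hemisphere n j, altInd (!b) (flagLabels lab F (Finset.range (j + 1))) := by
  have hfix : ∀ F : Equiv.Perm (Fin n) × (Fin n → Bool),
      ((∀ i : Fin n, j + 1 < (i : ℕ) → F.1 i = i) ∧ F.1 ⟨j + 1, hj⟩ = ⟨j + 1, hj⟩) ↔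
        ∀ i : Fin n, j < (i : ℕ) → F.1 i = i := by
    refine fun F => ⟨fun h i hi => ?_, fun h => ⟨fun i hi => h i (by omega), h _ (by simp)⟩⟩
    rcases (Nat.succ_le_of_lt hi).eq_or_lt with h' | h'
    · rw [show i = ⟨j + 1, hj⟩ from Fin.ext h'.symm, h.2]
    · exact h.1 i h'
  rw [← Finset.sum_filter_add_sum_filter_not _ (fun F => F.2 ⟨j, by omega⟩ = true)]
  congr 1
  · apply Finset.sum_congr _ fun _ _ => rfl
    ext F
    simp only [hemisphere, Finset.mem_filter, Finset.mem_univ, true_and]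
    rw [← hfix F]
    have : (∀ i : Fin n, j ≤ (i : ℕ) → F.2 i = true) ↔
        (∀ i : Fin n, j + 1 ≤ (i : ℕ) → F.2 i = true) ∧ F.2 ⟨j, by omega⟩ = true := by
      refine ⟨fun h => ⟨fun i hi => h i (by omega), h _ le_rfl⟩, fun h i hi => ?_⟩
      rcases hi.eq_or_lt with h' | h'
      · rw [show i = ⟨j, by omega⟩ from Fin.ext h'.symm, h.2]
      · exact h.1 i h'
    rw [this]
    tauto
  · refine Finset.sum_nbij' (flipFlag (j + 1)) (flipFlag (j + 1)) ?_ ?_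
      (fun F _ => flipFlag_flipFlag _ F) (fun F _ => flipFlag_flipFlag _ F) ?_
    · intro F hF
      simp only [hemisphere, Finset.mem_filter, Finset.mem_univ, true_and] at hF ⊢
      refine ⟨(hfix F).1 ⟨hF.1.1.1, hF.1.2⟩, fun i hi => ?_⟩
      rcases hi.eq_or_lt with h' | h'
      · have : i = ⟨j, by omega⟩ := Fin.ext h'.symm
        have h2 := hF.2
        rw [← this] at h2
        simp [flipFlag, ← h', h2]
      · simp only [flipFlag]
        rw [if_neg (by omega), hF.1.1.2 i h']
    · intro F hF
      simp only [hemisphere, Finset.mem_filter, Finset.mem_univ, true_and] at hF ⊢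
      have h1 := (hfix F).2 hF.1
      refine ⟨⟨⟨h1.1, fun i hi => ?_⟩, h1.2⟩, ?_⟩
      · simp only [flipFlag]
        rw [if_neg (by omega), hF.2 i (by omega)]
      · simp [flipFlag, hF.2 ⟨j, by omega⟩ le_rfl]
    · intro F hF
      simp only [hemisphere, Finset.mem_filter, Finset.mem_univ, true_and] at hF
      rw [hlab.altInd_flipFlag (by omega) ((hfix F).1 ⟨hF.1.1.1, hF.1.2⟩), Bool.not_not]

theorem IsTuckerLabelling.sum_hemisphere (hlab : IsTuckerLabelling lab) {j : ℕ} (hj : j < n) :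
    ∑ F ∈ hemisphere n j, (altInd true (flagLabels lab F (Finset.range (j + 1))) +
      altInd false (flagLabels lab F (Finset.range (j + 1)))) = 1 := by
  induction j with
  | zero =>
    have : hemisphere n 0 = {(1, fun _ => true)} := by
      ext F
      simp only [hemisphere, Finset.mem_filter, Finset.mem_univ, true_and, Finset.mem_singleton,
        zero_le, forall_const]
      constructor
      · rintro ⟨h1, h2⟩
        refine Prod.ext (Equiv.ext fun i => ?_) (funext h2)
        by_cases hi : (i : ℕ) = 0
        · by_contra hne
          refine hne (F.1.injective (h1 _ ?_))
          rw [Equiv.Perm.one_apply, Fin.ext_iff] at hne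
          omega
        · exact h1 i (by omega)
      · rintro rfl
        simp
    rw [this, Finset.sum_singleton]
    simp only [flagLabels, zero_add, Finset.range_one, Finset.singleton_val,
      Multiset.map_singleton, altInd, Multiset.sort_singleton, List.map_cons, List.map_nil]
    cases (ofLex (lab (flagPart (1, fun _ => true) true 0)
      (flagPart (1, fun _ => true) false 0))).2 <;> simp [altSign]
  | succ j ih =>
    simp_rw [← sum_altInd_flagLabels_erase lab _ true]
    rw [Finset.sum_comm, Finset.sum_range_succ, Finset.sum_eq_zero, zero_add,
      ← Finset.sum_filter_add_sum_filter_not _ (fun F => F.1 ⟨j + 1, hj⟩ = ⟨j + 1, hj⟩)]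
    · have : (Finset.range (j + 1 + 1)).erase (j + 1) = Finset.range (j + 1) := by
        rw [Finset.range_add_one, Finset.erase_insert (by simp)]
      rw [this, sum_hemisphere_filter_ne lab true hj, add_zero,
        hlab.sum_hemisphere_filter_eq true hj, ← Finset.sum_add_distrib]
      exact ih (by omega)
    · intro r hr
      exact sum_hemisphere_erase_of_lt lab true hj (Finset.mem_range.1 hr)

/-- The octahedral Tucker lemma. -/
theorem IsTuckerLabelling.exists_le (hlab : IsTuckerLabelling lab) (hn : 0 < n) :
    ∃ A B, Disjoint A B ∧ (A ∪ B).Nonempty ∧ n ≤ (ofLex (lab A B)).1 + 1 := by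
  have hsum := hlab.sum_hemisphere (j := n - 1) (by omega)
  rw [Nat.sub_add_cancel hn] at hsum
  obtain ⟨F, -, hF⟩ := Finset.exists_ne_zero_of_sum_ne_zero (hsum.trans_ne one_ne_zero)
  have hnodup : (flagLabels lab F (Finset.range n)).Nodup := by
    by_cases h : altInd true (flagLabels lab F (Finset.range n)) = 0
    · rw [h, zero_add] at hF
      exact nodup_of_altInd_ne_zero _ _ hF
    · exact nodup_of_altInd_ne_zero _ _ h
  have hinj := Multiset.inj_on_of_nodup_map hnodup
  by_contra! hlt
  obtain ⟨r, hr, s, hs, hrs, heq⟩ := Finset.exists_ne_map_eq_of_card_lt_of_maps_to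
    (s := Finset.range n) (t := Finset.range (n - 1)) (by simpa using hn)
    (f := fun r => (ofLex (lab (flagPart F true r) (flagPart F false r))).1) (by
      intro r hr
      have := hlt _ _ (disjoint_flagPart F r r) (flagPart_union_nonempty F (by simpa using hr))
      simp only [Finset.coe_range, Set.mem_Iio]
      omega)
  refine hrs (hinj _ hr _ hs (ofLex.injective (Prod.ext heq ?_)))
  exact hlab.sign_eq_of_flag F (by simpa using hr) (by simpa using hs) heq

end Tucker

/-- The maximal length of a sequence of integers below `k` that lie alternately in `A` and `B`,
with the last one in `A`. -/
def altLen : Finset ℕ → Finset ℕ → ℕ → ℕ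
  | _, _, 0 => 0
  | A, B, k + 1 => if k ∈ A then altLen B A k + 1 else altLen A B k

section AltLen

variable {A B A' B' : Finset ℕ}

theorem altLen_le_add_one (h : Disjoint A B) (k : ℕ) : altLen A B k ≤ altLen B A k + 1 := by
  induction k generalizing A B with
  | zero => simp [altLen]
  | succ k ih =>
    have h1 := ih h
    have h2 : k ∈ A → k ∉ B := fun hA => Finset.disjoint_left.1 h hA
    simp only [altLen]
    grind

theorem altLen_ne (h : Disjoint A B) {k v : ℕ} (hv : v ∈ A ∪ B) (hvk : v < k) :
    altLen A B k ≠ altLen B A k := by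
  induction k with
  | zero => omega
  | succ k ih =>
    have h1 := altLen_le_add_one h k
    have h2 := altLen_le_add_one h.symm k
    have h3 : k ∈ A → k ∉ B := fun hA => Finset.disjoint_left.1 h hA
    simp only [altLen]
    by_cases hkv : v < k
    · have := ih hkv
      grind
    · obtain rfl : v = k := by omega
      rw [Finset.mem_union] at hv
      grind

theorem altLen_mono (h : Disjoint A' B') (hA : A ⊆ A') (hB : B ⊆ B') (k : ℕ) :
    altLen A B k ≤ altLen A' B' k := by
  induction k generalizing A B A' B' with
  | zero => simp [altLen]
  | succ k ih =>
    have h1 := ih h hA hB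
    have h2 := ih h.symm hB hA
    have h3 := altLen_le_add_one h k
    have h4 : k ∈ A → k ∈ A' := fun hk => hA hk
    simp only [altLen]
    grind

theorem card_filter_lt_succ (S : Finset ℕ) (k : ℕ) :
    (S.filter (· < k + 1)).card = (S.filter (· < k)).card + if k ∈ S then 1 else 0 := by
  have hsplit : S.filter (· < k + 1) = S.filter (· < k) ∪ S.filter (· = k) := by
    rw [← Finset.filter_or]
    exact Finset.filter_congr fun x _ => by omega
  rw [hsplit, Finset.card_union_of_disjoint, Finset.filter_eq']
  · split_ifs <;> simp
  · exact Finset.disjoint_filter.2 fun x _ h h' => by omega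

theorem altLen_le_card (h : Disjoint A B) (k : ℕ) :
    altLen A B k ≤ ((A ∪ B).filter (· < k)).card := by
  induction k generalizing A B with
  | zero => simp [altLen]
  | succ k ih =>
    have h1 := ih h
    have h2 := ih h.symm
    rw [Finset.union_comm] at h2
    rw [card_filter_lt_succ]
    simp only [altLen, Finset.mem_union]
    grind

theorem altLen_lt_card (h : Disjoint A B) {k v : ℕ} (hv : v ∈ A) (hv' : v + 1 ∈ A)
    (hk : v + 1 < k) :
    altLen A B k < ((A ∪ B).filter (· < k)).card ∧
      altLen B A k < ((A ∪ B).filter (· < k)).card := by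
  induction k with
  | zero => omega
  | succ k ih =>
    rw [card_filter_lt_succ]
    by_cases hvk : v + 1 < k
    · have := ih hvk
      simp only [altLen, Finset.mem_union]
      grind
    · obtain rfl : k = v + 1 := by omega
      have h1 := altLen_le_card h v
      have h2 := altLen_le_card h.symm v
      have h3 := Finset.disjoint_left.1 h hv
      have h4 := Finset.disjoint_left.1 h hv'
      rw [Finset.union_comm] at h2
      rw [card_filter_lt_succ]
      simp only [altLen, Finset.mem_union, hv, hv', h3, h4]
      grind

theorem pathIndepSet_of_card_le (h : Disjoint A B) {k : ℕ} (hA : ∀ v ∈ A, v < k)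
    (hle : (A ∪ B).card ≤ max (altLen A B k) (altLen B A k)) : PathIndepSet A := by
  intro v hv hv'
  have h1 := altLen_lt_card h hv hv' (hA _ hv')
  have h2 := Finset.card_filter_le (A ∪ B) (· < k)
  omega

end AltLen

section Splitting

variable {m : ℕ} (V : Fin m → Finset ℕ)

/-- The indices of the sets of which `A` or `B` contains more than half. -/
def majorityIndices (A B : Finset ℕ) : Set ℕ :=
  {i | ∃ h : i < m, (V ⟨i, h⟩).card < 2 * (A ∩ V ⟨i, h⟩).card ∨
    (V ⟨i, h⟩).card < 2 * (B ∩ V ⟨i, h⟩).card}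

theorem majorityIndices_comm (A B : Finset ℕ) :
    majorityIndices V A B = majorityIndices V B A := by
  ext i
  simp only [majorityIndices, Set.mem_ofPred_eq, or_comm]

theorem majority_not_both {A B S : Finset ℕ} (h : Disjoint A B)
    (hA : S.card < 2 * (A ∩ S).card) : ¬ S.card < 2 * (B ∩ S).card := by
  have h1 : (A ∩ S ∪ B ∩ S).card ≤ S.card :=
    Finset.card_le_card (Finset.union_subset Finset.inter_subset_right Finset.inter_subset_right)
  rw [Finset.card_union_of_disjoint
    (h.mono Finset.inter_subset_left Finset.inter_subset_left)] at h1
  omega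

open Classical in
/-- A labelling of signed sets by the maximal length of an alternating sequence if this is at most
`l`, and by a set in which one of the signs has the majority otherwise. -/
noncomputable def splitLabel (n l : ℕ) (A B : Finset ℕ) : ℕ ×ₗ Bool :=
  if max (altLen A B (n + 1)) (altLen B A (n + 1)) < l then
    toLex (max (altLen A B (n + 1)) (altLen B A (n + 1)) - 1,
      decide (altLen B A (n + 1) < altLen A B (n + 1)))
  else
    toLex (l - 1 + sInf (majorityIndices V A B),
      decide (∃ h : sInf (majorityIndices V A B) < m,
        (V ⟨sInf (majorityIndices V A B), h⟩).card <
          2 * (A ∩ V ⟨sInf (majorityIndices V A B), h⟩).card))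

variable {V}

theorem splitLabel_swap {n l : ℕ} {A B : Finset ℕ} (h : Disjoint A B)
    (hne : ∃ v ∈ A ∪ B, v < n + 1)
    (hmaj : l ≤ max (altLen A B (n + 1)) (altLen B A (n + 1)) →
      (majorityIndices V A B).Nonempty) :
    splitLabel V n l B A = flipSign (splitLabel V n l A B) := by
  obtain ⟨v, hv, hvn⟩ := hne
  have hlen := altLen_ne h hv hvn
  rw [splitLabel, splitLabel, max_comm, majorityIndices_comm V B A]
  split_ifs with hl
  · simp only [flipSign, ofLex_toLex]
    congr 2
    rw [← decide_not, decide_eq_decide]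
    omega
  · simp only [flipSign, ofLex_toLex]
    congr 2
    rw [← decide_not, decide_eq_decide]
    obtain ⟨hm, hor⟩ := Nat.sInf_mem (hmaj (not_lt.1 hl))
    constructor
    · rintro ⟨_, hB⟩ ⟨_, hA⟩
      exact majority_not_both h hA hB
    · exact fun hA => ⟨hm, hor.resolve_left fun h' => hA ⟨hm, h'⟩⟩

theorem splitLabel_sign_eq {n l : ℕ} {A B A' B' : Finset ℕ} (h : Disjoint A' B')
    (hA : A ⊆ A') (hB : B ⊆ B') (hne : ∃ v ∈ A ∪ B, v < n + 1)
    (hmaj : l ≤ max (altLen A B (n + 1)) (altLen B A (n + 1)) →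
      (majorityIndices V A B).Nonempty)
    (heq : (ofLex (splitLabel V n l A B)).1 = (ofLex (splitLabel V n l A' B')).1) :
    (ofLex (splitLabel V n l A B)).2 = (ofLex (splitLabel V n l A' B')).2 := by
  obtain ⟨v, hv, hvn⟩ := hne
  have hdisj : Disjoint A B := h.mono hA hB
  have hlen := altLen_ne hdisj hv hvn
  have hlen' := altLen_ne h (Finset.union_subset_union hA hB hv) hvn
  have h1 := altLen_mono h hA hB (n + 1)
  have h2 := altLen_mono h.symm hB hA (n + 1)
  rw [splitLabel, splitLabel] at heq ⊢
  by_cases hl : max (altLen A B (n + 1)) (altLen B A (n + 1)) < l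
  · by_cases hl' : max (altLen A' B' (n + 1)) (altLen B' A' (n + 1)) < l
    · simp only [hl, hl', if_true, ofLex_toLex] at heq ⊢
      rw [decide_eq_decide]
      omega
    · simp only [hl, hl', if_true, if_false, ofLex_toLex] at heq
      omega
  · have hl' : ¬ max (altLen A' B' (n + 1)) (altLen B' A' (n + 1)) < l := by omega
    simp only [hl, hl', if_false, ofLex_toLex, add_right_inj] at heq ⊢
    rw [← heq, decide_eq_decide]
    obtain ⟨hm, hor⟩ := Nat.sInf_mem (hmaj (not_lt.1 hl))
    have hA' := Finset.card_le_card
      (Finset.inter_subset_inter_right (u := V ⟨sInf (majorityIndices V A B), hm⟩) hA)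
    have hB' := Finset.card_le_card
      (Finset.inter_subset_inter_right (u := V ⟨sInf (majorityIndices V A B), hm⟩) hB)
    constructor
    · rintro ⟨_, hlt⟩
      exact ⟨hm, by omega⟩
    · rintro ⟨_, hlt⟩
      refine ⟨hm, hor.resolve_right fun hlt' => majority_not_both h hlt ?_⟩
      omega

theorem card_eq_sum_inter {n : ℕ} {A : Finset ℕ}
    (hdisj : ∀ i j, i ≠ j → Disjoint (V i) (V j))
    (hcover : ∀ v ∈ Finset.Icc 1 n, ∃ i, v ∈ V i) (hA : A ⊆ Finset.Icc 1 n) :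
    A.card = ∑ i, (A ∩ V i).card := by
  rw [← Finset.card_biUnion, ← Finset.inter_biUnion, Finset.inter_eq_left.2]
  · intro v hv
    obtain ⟨i, hi⟩ := hcover v (hA hv)
    exact Finset.mem_biUnion.2 ⟨i, Finset.mem_univ i, hi⟩
  · exact fun i _ j _ hij =>
      (hdisj i j hij).mono Finset.inter_subset_right Finset.inter_subset_right

end Splitting

theorem fair_splitting_of_path (n m : ℕ)
    (V : Fin m → Finset ℕ)
    (hsub : ∀ i, V i ⊆ Finset.Icc 1 n)
    (hdisj : ∀ i j, i ≠ j → Disjoint (V i) (V j))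
    (hne : ∀ i, (V i).Nonempty)
    (hcover : ∀ v ∈ Finset.Icc 1 n, ∃ i, v ∈ V i)
    (hodd : ∀ i, Odd (V i).card) :
    ∃ S₁ S₂ : Finset ℕ,
      S₁ ⊆ Finset.Icc 1 n ∧ S₂ ⊆ Finset.Icc 1 n ∧
      Disjoint S₁ S₂ ∧ PathIndepSet S₁ ∧ PathIndepSet S₂ ∧
      n - m ≤ (S₁ ∪ S₂).card ∧
      ∀ i, 2 * (S₁ ∩ V i).card + 1 = (V i).card := by
  by_contra hcon
  have hn : ∑ i, (V i).card = n := by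
    have h := card_eq_sum_inter hdisj hcover (subset_refl (Finset.Icc 1 n))
    rw [Nat.card_Icc, Nat.add_sub_cancel] at h
    rw [h]
    exact Finset.sum_congr rfl fun i _ => by rw [Finset.inter_eq_right.2 (hsub i)]
  have hmaj : ∀ A B : Finset ℕ, A ⊆ Finset.Icc 1 n → B ⊆ Finset.Icc 1 n → Disjoint A B →
      n - m ≤ max (altLen A B (n + 1)) (altLen B A (n + 1)) →
      (majorityIndices V A B).Nonempty := by
    intro A B hA hB hAB hle
    rw [Set.nonempty_iff_ne_empty]
    intro hempty
    have hsmall : ∀ i, 2 * (A ∩ V i).card + 1 ≤ (V i).card ∧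
        2 * (B ∩ V i).card + 1 ≤ (V i).card := by
      intro i
      obtain ⟨t, ht⟩ := hodd i
      have hi : (i : ℕ) ∉ majorityIndices V A B := by rw [hempty]; exact Set.notMem_empty _
      simp only [majorityIndices, Set.mem_ofPred_eq, Fin.eta, not_exists, not_or] at hi
      have := hi i.2
      omega
    have hsum : ∀ C : Finset ℕ, C ⊆ Finset.Icc 1 n →
        ∑ i, (2 * (C ∩ V i).card + 1) = 2 * C.card + m := by
      intro C hC
      rw [Finset.sum_add_distrib, ← Finset.mul_sum, ← card_eq_sum_inter hdisj hcover hC]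
      simp
    have hsumA := hsum A hA
    have hsumB := hsum B hB
    have hleA := Finset.sum_le_sum fun i (_ : i ∈ Finset.univ) => (hsmall i).1
    have hleB := Finset.sum_le_sum fun i (_ : i ∈ Finset.univ) => (hsmall i).2
    have hcard := Finset.card_union_of_disjoint hAB
    have h1 := altLen_le_card hAB (n + 1)
    have h2 := altLen_le_card hAB.symm (n + 1)
    rw [Finset.union_comm] at h2
    have h3 := Finset.card_filter_le (A ∪ B) (· < n + 1)
    have hlt : ∀ C ⊆ Finset.Icc 1 n, ∀ v ∈ C, v < n + 1 := fun C hC v hv =>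
      Nat.lt_succ_of_le (Finset.mem_Icc.1 (hC hv)).2
    refine hcon ⟨A, B, hA, hB, hAB, pathIndepSet_of_card_le hAB (hlt A hA) (by omega),
      pathIndepSet_of_card_le hAB.symm (hlt B hB)
        (by rw [Finset.union_comm B A, max_comm]; omega), by omega, ?_⟩
    have heq : ∑ i, (2 * (A ∩ V i).card + 1) = ∑ i, (V i).card := by omega
    exact fun i => (Finset.sum_eq_sum_iff_of_le fun i _ => (hsmall i).1).1 heq i
      (Finset.mem_univ i)
  have hpos : 0 < n - m := by
    by_contra h0
    obtain ⟨i, hm, h⟩ := hmaj ∅ ∅ (by simp) (by simp) (by simp) (by omega)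
    simp at h
  let e : Fin n ↪ ℕ := ⟨fun i => i + 1, fun i j h => Fin.ext (Nat.succ_injective h)⟩
  have hsubset : ∀ A : Finset (Fin n), A.map e ⊆ Finset.Icc 1 n := by
    intro A v hv
    obtain ⟨i, -, rfl⟩ := Finset.mem_map.1 hv
    exact Finset.mem_Icc.2 ⟨Nat.succ_pos _, i.2⟩
  have hex : ∀ A B : Finset (Fin n), (A ∪ B).Nonempty → ∃ v ∈ A.map e ∪ B.map e, v < n + 1 := by
    rintro A B ⟨i, hi⟩
    rw [← Finset.map_union]
    exact ⟨e i, Finset.mem_map_of_mem e hi, Nat.succ_lt_succ i.2⟩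
  have hlab : IsTuckerLabelling fun A B : Finset (Fin n) =>
      splitLabel V n (n - m) (A.map e) (B.map e) := by
    constructor
    · intro A B hAB hne
      have hAB' := (Finset.disjoint_map e).2 hAB
      exact splitLabel_swap hAB' (hex A B hne) (hmaj _ _ (hsubset A) (hsubset B) hAB')
    · intro A B A' B' hAB hne hA hB heq
      have hAB' := (Finset.disjoint_map e).2 hAB
      have hA' := Finset.map_subset_map (f := e) |>.2 hA
      have hB' := Finset.map_subset_map (f := e) |>.2 hB
      exact splitLabel_sign_eq hAB' hA' hB' (hex A B hne)
        (hmaj _ _ (hsubset A) (hsubset B) (hAB'.mono hA' hB')) heq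
  obtain ⟨A, B, hAB, hne, hle⟩ := hlab.exists_le (by omega)
  have hAB' := (Finset.disjoint_map e).2 hAB
  obtain ⟨v, hv, hvn⟩ := hex A B hne
  have hlen := altLen_ne hAB' hv hvn
  simp only [splitLabel] at hle
  split_ifs at hle with hl
  · simp only [ofLex_toLex] at hle
    omega
  · obtain ⟨hm, -⟩ := Nat.sInf_mem (hmaj _ _ (hsubset A) (hsubset B) hAB' (not_lt.1 hl))
    simp only [ofLex_toLex] at hle
    omega
end

section
/- Let k, m ≥ 1 and n = 2k + m, and let V_1, …, V_m be a partition of {1,…,n} where |V_i| = 2r_i + 1 for nonnegative integers r_i (so that k = r_1 + ⋯ + r_m). For a k-element subset S of {1,…,n}, define c(S) to be the smallest i ∈ {1,…,m} such that |S ∩ V_i| ≥ r_i + 1, if such an i exists, and c(S) = m + 1 otherwise. If S_1 and S_2 are disjoint k-element subsets of {1,…,n} with c(S_1) = c(S_2), then c(S_1) = c(S_2) = m + 1 and |S_1 ∩ V_i| = |S_2 ∩ V_i| = r_i for every i ∈ {1,…,m}; in particular, S_1 and S_2 together cover all elements of each V_i except exactly one. -/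
/-- The coloring used in the reduction from `FISC` to the Schrijver graph problem:
the color of a `k`-subset `S` is the smallest `i ∈ {1, …, m}` (encoded as `i.val + 1`
for `i : Fin m`) such that `|S ∩ V i| ≥ r i + 1`, if such an `i` exists,
and `m + 1` otherwise. -/
def colorC {m : ℕ} (V : Fin m → Finset ℕ) (r : Fin m → ℕ) (S : Finset ℕ) : ℕ :=
  if h : ∃ i : Fin m, r i + 1 ≤ (S ∩ V i).card then
    ((Finset.univ.filter fun i : Fin m => r i + 1 ≤ (S ∩ V i).card).min'
      (by obtain ⟨i, hi⟩ := h; exact ⟨i, by simpa using hi⟩)).val + 1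
  else m + 1

theorem colorC_eq_or_exists {m : ℕ} (V : Fin m → Finset ℕ) (r : Fin m → ℕ) (S : Finset ℕ) :
    (colorC V r S = m + 1 ∧ ∀ i, (S ∩ V i).card ≤ r i) ∨
      ∃ i : Fin m, colorC V r S = i.val + 1 ∧ r i + 1 ≤ (S ∩ V i).card := by
  unfold colorC
  split_ifs with h
  · refine Or.inr ⟨_, rfl, ?_⟩
    exact (Finset.mem_filter.mp (Finset.min'_mem
      (Finset.univ.filter fun i : Fin m => r i + 1 ≤ (S ∩ V i).card) _)).2
  · push Not at h
    exact Or.inl ⟨rfl, fun i => Nat.le_of_lt_succ (h i)⟩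

theorem card_inter_add_card_inter_add_card_sdiff {α : Type*} [DecidableEq α]
    {S T : Finset α} (h : Disjoint S T) (V : Finset α) :
    (S ∩ V).card + (T ∩ V).card + (V \ (S ∪ T)).card = V.card := by
  rw [← Finset.card_union_of_disjoint
      (h.mono Finset.inter_subset_left Finset.inter_subset_left),
    ← Finset.union_inter_distrib_right, Finset.inter_comm, Finset.card_inter_add_card_sdiff]

theorem sum_card_inter_eq_card {ι α : Type*} [Fintype ι] [DecidableEq α]
    {V : ι → Finset α} (hdisj : ∀ i j, i ≠ j → Disjoint (V i) (V j))
    {S : Finset α} (hS : ∀ v ∈ S, ∃ i, v ∈ V i) :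
    ∑ i, (S ∩ V i).card = S.card := by
  rw [← Finset.card_biUnion fun i _ j _ hij =>
    (hdisj i j hij).mono Finset.inter_subset_right Finset.inter_subset_right]
  congr 1
  ext v
  simp only [Finset.mem_biUnion, Finset.mem_univ, true_and, Finset.mem_inter]
  exact ⟨fun ⟨_, hv, _⟩ => hv, fun hv => (hS v hv).imp fun _ hi => ⟨hv, hi⟩⟩

theorem monochromatic_pair_is_fair (k m n : ℕ) (hk : 1 ≤ k) (hm : 1 ≤ m)
    (hn : n = 2 * k + m)
    (V : Fin m → Finset ℕ) (r : Fin m → ℕ)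
    (hsub : ∀ i, V i ⊆ Finset.Icc 1 n)
    (hdisj : ∀ i j, i ≠ j → Disjoint (V i) (V j))
    (hne : ∀ i, (V i).Nonempty)
    (hcover : ∀ v ∈ Finset.Icc 1 n, ∃ i, v ∈ V i)
    (hsize : ∀ i, (V i).card = 2 * r i + 1)
    (hkr : k = ∑ i, r i)
    (S₁ S₂ : Finset ℕ)
    (hS₁ : S₁ ⊆ Finset.Icc 1 n) (hS₂ : S₂ ⊆ Finset.Icc 1 n)
    (hc₁ : S₁.card = k) (hc₂ : S₂.card = k)
    (hd : Disjoint S₁ S₂)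
    (hcc : colorC V r S₁ = colorC V r S₂) :
    colorC V r S₁ = m + 1 ∧ colorC V r S₂ = m + 1 ∧
    (∀ i, (S₁ ∩ V i).card = r i ∧ (S₂ ∩ V i).card = r i) ∧
    (∀ i, (V i \ (S₁ ∪ S₂)).card = 1) := by
  have hpart i := card_inter_add_card_inter_add_card_sdiff hd (V i)
  have heq {S : Finset ℕ} (hS : S ⊆ Finset.Icc 1 n) (hc : S.card = k)
      (hle : ∀ i, (S ∩ V i).card ≤ r i) (i : Fin m) : (S ∩ V i).card = r i :=
    (Finset.sum_eq_sum_iff_of_le fun i _ => hle i).mp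
      (by rw [sum_card_inter_eq_card hdisj fun v hv => hcover v (hS hv), hc, hkr])
      i (Finset.mem_univ i)
  rcases colorC_eq_or_exists V r S₁ with ⟨h₁, hle₁⟩ | ⟨i, h₁, hi⟩ <;>
    rcases colorC_eq_or_exists V r S₂ with ⟨h₂, hle₂⟩ | ⟨j, h₂, hj⟩
  · have e₁ := heq hS₁ hc₁ hle₁
    have e₂ := heq hS₂ hc₂ hle₂
    refine ⟨h₁, h₂, fun i => ⟨e₁ i, e₂ i⟩, fun i => ?_⟩
    have := hpart i
    rw [e₁, e₂, hsize] at this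
    omega
  · have := j.isLt
    omega
  · have := i.isLt
    omega
  · obtain rfl : i = j := Fin.ext (by omega)
    have := hpart i
    rw [hsize] at this
    omega
end

section
/- Let k ≥ 1 and n ≥ 2k be integers and let c be any function assigning to each stable k-element subset of {1,…,n} a color from a set of n − 2k + 1 colors. Then there exist two disjoint stable k-element subsets S_1 and S_2 of {1,…,n} with c(S_1) = c(S_2). -/
/-- A subset `A` of `{1, …, n}` is stable if it contains no two consecutive
elements modulo `n`: if `i ∈ A` with `i < n` then `i + 1 ∉ A`, and not both
`n ∈ A` and `1 ∈ A`. -/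
def IsStableSet (n : ℕ) (A : Finset ℕ) : Prop :=
  (∀ i ∈ A, i < n → i + 1 ∉ A) ∧ ¬(n ∈ A ∧ 1 ∈ A)

open Finset

open scoped Pointwise

/-- A finite set of integers encodes a sign vector supported in `{1, …, n}` if its elements have
absolute value at most `n` and no two of them are opposite. -/
def IsSigned (n : ℕ) (X : Finset ℤ) : Prop := ∀ a ∈ X, -a ∉ X ∧ a.natAbs ≤ n

lemma IsSigned.subset {n : ℕ} {X Y : Finset ℤ} (hY : IsSigned n Y) (h : X ⊆ Y) : IsSigned n X :=
  fun a ha => ⟨fun hb => (hY a (h ha)).1 (h hb), (hY a (h ha)).2⟩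

lemma IsSigned.mono {m n : ℕ} {X : Finset ℤ} (hX : IsSigned m X) (h : m ≤ n) : IsSigned n X :=
  fun a ha => ⟨(hX a ha).1, (hX a ha).2.trans h⟩

lemma neg_erase_int (X : Finset ℤ) (a : ℤ) : (-X).erase (-a) = -(X.erase a) := by
  ext b
  simp only [Finset.mem_erase, Finset.mem_neg', ne_eq, neg_eq_iff_eq_neg]

lemma neg_insert_int (X : Finset ℤ) (a : ℤ) : -(insert a X) = insert (-a) (-X) := by
  ext b
  simp only [Finset.mem_insert, Finset.mem_neg', neg_eq_iff_eq_neg]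

lemma sum_neg_finset_int {M : Type*} [AddCommMonoid M] (X : Finset ℤ) (f : ℤ → M) :
    ∑ a ∈ -X, f a = ∑ a ∈ X, f (-a) := by
  rw [← Finset.image_neg_eq_neg, Finset.sum_image (fun _ _ _ _ h => neg_injective h)]

lemma sum_erase_erase_eq_zero {α : Type*} [DecidableEq α] (X : Finset α)
    (G : Finset α → ZMod 2) :
    ∑ a ∈ X, ∑ b ∈ X.erase a, G ((X.erase a).erase b) = 0 := by
  rw [Finset.sum_sigma']
  refine Finset.sum_involution (fun p _ => ⟨p.2, p.1⟩) ?_ ?_ ?_ ?_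
  · rintro ⟨a, b⟩ _
    simp only [Finset.erase_right_comm (a := b) (b := a)]
    exact CharTwo.add_self_eq_zero _
  · rintro ⟨a, b⟩ h _ heq
    simp only [Finset.mem_sigma, Finset.mem_erase] at h
    simp only [Sigma.mk.injEq] at heq
    exact h.2.1 heq.1
  · rintro ⟨a, b⟩ h
    simp only [Finset.mem_sigma, Finset.mem_erase] at h ⊢
    exact ⟨h.2.2, Ne.symm h.2.1, h.1⟩
  · rintro ⟨a, b⟩ _
    rfl

/-- For `X` with `d + 1` elements, the parity of the number of maximal chains of nonempty subsets
of `X` along which the sign `σ` changes at every step. -/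
def altChains {α : Type*} [DecidableEq α] (σ : Finset α → ZMod 2) : ℕ → Finset α → ZMod 2
  | 0, _ => 1
  | d + 1, X => ∑ a ∈ X, (σ (X.erase a) + σ X) * altChains σ d (X.erase a)

section AltChains

variable {α : Type*} [DecidableEq α] (σ : Finset α → ZMod 2)

lemma sum_altChains_erase (d : ℕ) (X : Finset α) (hX : X.card = d + 2) :
    ∑ a ∈ X, altChains σ d (X.erase a) = 0 := by
  induction d generalizing X with
  | zero =>
    simp only [altChains, Finset.sum_const, hX]
    decide
  | succ d ih =>
    have h : ∀ a ∈ X, altChains σ (d + 1) (X.erase a) =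
        ∑ b ∈ X.erase a, (fun Y => σ Y * altChains σ d Y) ((X.erase a).erase b) := by
      intro a ha
      have hc : (X.erase a).card = d + 2 := by
        rw [Finset.card_erase_of_mem ha, hX]
        rfl
      simp only [altChains, add_mul, Finset.sum_add_distrib]
      rw [← Finset.mul_sum, ih _ hc, mul_zero, add_zero]
    rw [Finset.sum_congr rfl h]
    exact sum_erase_erase_eq_zero X fun Y => σ Y * altChains σ d Y

lemma altChains_succ (d : ℕ) (X : Finset α) (hX : X.card = d + 2) :
    altChains σ (d + 1) X = ∑ a ∈ X, σ (X.erase a) * altChains σ d (X.erase a) := by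
  simp only [altChains, add_mul, Finset.sum_add_distrib]
  rw [← Finset.mul_sum, sum_altChains_erase σ d X hX, mul_zero, add_zero]

end AltChains

lemma altChains_neg {N : ℕ} (σ : Finset ℤ → ZMod 2)
    (hσ : ∀ X, IsSigned N X → X.Nonempty → σ (-X) = σ X + 1) (d : ℕ) (X : Finset ℤ)
    (hX : IsSigned N X) (hc : X.card = d + 1) : altChains σ d (-X) = altChains σ d X := by
  induction d generalizing X with
  | zero => rfl
  | succ d ih =>
    simp only [altChains]
    rw [sum_neg_finset_int]
    refine Finset.sum_congr rfl fun a ha => ?_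
    have hs : IsSigned N (X.erase a) := hX.subset (Finset.erase_subset _ _)
    have hc' : (X.erase a).card = d + 1 := by
      rw [Finset.card_erase_of_mem ha, hc]
      rfl
    rw [neg_erase_int, ih _ hs hc', hσ _ hX (Finset.card_pos.1 (by omega)),
      hσ _ hs (Finset.card_pos.1 (by omega))]
    congr 1
    have : (1 : ZMod 2) + 1 = 0 := by decide
    linear_combination this

/-- The sum of `G` over all sign vectors of full support `{1, …, n}`. -/
def signSum : ℕ → (Finset ℤ → ZMod 2) → ZMod 2
  | 0, G => G ∅
  | n + 1, G => signSum n (fun X => G (insert ((n : ℤ) + 1) X)) +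
      signSum n (fun X => G (insert (-((n : ℤ) + 1)) X))

/-- `X` encodes a sign vector of full support `{1, …, n}`. -/
def IsFullSigned (n : ℕ) (X : Finset ℤ) : Prop :=
  IsSigned n X ∧ X.card = n

lemma IsFullSigned.notMem {n : ℕ} {X : Finset ℤ} (h : IsFullSigned n X) {a : ℤ}
    (ha : a.natAbs = n + 1) : a ∉ X := fun hm => by
  have := (h.1 a hm).2
  omega

lemma IsFullSigned.insert {n : ℕ} {X : Finset ℤ} (h : IsFullSigned n X) {a : ℤ}
    (ha : a.natAbs = n + 1) : IsFullSigned (n + 1) (insert a X) := by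
  refine ⟨fun b hb => ⟨fun hb' => ?_, ?_⟩, ?_⟩
  · rw [Finset.mem_insert] at hb hb'
    rcases hb with rfl | hb <;> rcases hb' with hb' | hb'
    · omega
    · exact h.notMem (by omega) hb'
    · exact h.notMem (by omega) hb
    · exact (h.1 b hb).1 hb'
  · rcases Finset.mem_insert.1 hb with rfl | hb
    · omega
    · exact (h.1 b hb).2.trans (Nat.le_succ n)
  · rw [Finset.card_insert_of_notMem (h.notMem ha), h.2]

lemma signSum_congr (n : ℕ) (G H : Finset ℤ → ZMod 2)
    (h : ∀ X, IsFullSigned n X → G X = H X) : signSum n G = signSum n H := by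
  induction n generalizing G H with
  | zero => exact h ∅ ⟨by simp [IsSigned], rfl⟩
  | succ n ih =>
    simp only [signSum]
    congr 1
    · exact ih _ _ fun X hX => h _ (hX.insert (by omega))
    · exact ih _ _ fun X hX => h _ (hX.insert (by omega))

lemma signSum_add (n : ℕ) (G H : Finset ℤ → ZMod 2) :
    signSum n (fun X => G X + H X) = signSum n G + signSum n H := by
  induction n generalizing G H with
  | zero => rfl
  | succ n ih =>
    simp only [signSum, ih]
    ring

lemma signSum_zero (n : ℕ) : signSum n (fun _ => 0) = 0 := by
  induction n with
  | zero => rfl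
  | succ n ih => simp only [signSum, ih, add_zero]

lemma signSum_neg (n : ℕ) (G : Finset ℤ → ZMod 2) :
    signSum n (fun X => G (-X)) = signSum n G := by
  induction n generalizing G with
  | zero => rfl
  | succ n ih =>
    simp only [signSum, neg_insert_int, neg_neg]
    rw [ih (fun X => G (insert (-((n : ℤ) + 1)) X)), ih (fun X => G (insert ((n : ℤ) + 1) X)),
      add_comm]

lemma sum_erase_insert {α M : Type*} [DecidableEq α] [AddCommMonoid M] {X : Finset α} {a : α}
    (ha : a ∉ X) (G : Finset α → M) :
    ∑ b ∈ insert a X, G ((insert a X).erase b) =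
      G X + ∑ b ∈ X, G (insert a (X.erase b)) := by
  rw [Finset.sum_insert ha, Finset.erase_insert ha]
  congr 1
  refine Finset.sum_congr rfl fun b hb => ?_
  rw [Finset.erase_insert_of_ne]
  rintro rfl
  exact ha hb

lemma signSum_sum_erase (n : ℕ) (G : Finset ℤ → ZMod 2) :
    signSum n (fun X => ∑ a ∈ X, G (X.erase a)) = 0 := by
  induction n generalizing G with
  | zero => rfl
  | succ n ih =>
    have key : ∀ e : ℤ, e.natAbs = n + 1 →
        signSum n (fun X => ∑ b ∈ insert e X, G ((insert e X).erase b)) = signSum n G := by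
      intro e he
      rw [signSum_congr n _ _ fun X hX => sum_erase_insert (hX.notMem he) G, signSum_add,
        ih (fun X => G (insert e X)), add_zero]
    simp only [signSum]
    rw [key _ (by omega), key _ (by omega)]
    exact CharTwo.add_self_eq_zero _

lemma signSum_altChains {N : ℕ} (σ : Finset ℤ → ZMod 2)
    (hσ : ∀ X, IsSigned N X → X.Nonempty → σ (-X) = σ X + 1) (n : ℕ)
    (hn : n < N) : signSum n (fun X => altChains σ n (insert ((n : ℤ) + 1) X)) = 1 := by
  induction n with
  | zero => rfl
  | succ n ih =>
    set e : ℤ := ((n + 1 : ℕ) : ℤ) + 1 with he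
    have h1 : ∀ X, IsFullSigned (n + 1) X → altChains σ (n + 1) (insert e X) =
        σ X * altChains σ n X +
          ∑ b ∈ X, σ (insert e (X.erase b)) * altChains σ n (insert e (X.erase b)) := by
      intro X hX
      have hX' := hX.insert (a := e) (by omega)
      rw [altChains_succ σ n _ hX'.2]
      exact sum_erase_insert (hX.notMem (by omega)) (fun Y => σ Y * altChains σ n Y)
    rw [signSum_congr _ _ _ h1, signSum_add,
      signSum_sum_erase (n + 1) (fun Y => σ (insert e Y) * altChains σ n (insert e Y)), add_zero]
    simp only [signSum]
    rw [← signSum_neg n (fun X => σ (insert (-((n : ℤ) + 1)) X) *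
      altChains σ n (insert (-((n : ℤ) + 1)) X)), ← signSum_add, ← ih (by omega)]
    refine signSum_congr _ _ _ fun X hX => ?_
    have hX' := hX.insert (a := (n : ℤ) + 1) (by omega)
    have hXN := hX'.1.mono (Nat.le_of_lt hn)
    rw [← neg_insert_int, altChains_neg σ hσ n _ hXN hX'.2,
      hσ _ hXN (Finset.insert_nonempty _ _), ← add_mul]
    have h2 : ∀ z : ZMod 2, z + (z + 1) = 1 := by decide
    rw [h2, one_mul]

/-- A form of Tucker's lemma: a monotone function on sign vectors supported in `{1, …, n}` that
separates antipodes takes a value at least `n`. -/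
lemma exists_le_of_monotone_of_ne_neg (n : ℕ) (F : Finset ℤ → ℕ) (hF : Monotone F)
    (hne : ∀ X, IsSigned n X → X.Nonempty → F X ≠ F (-X)) : ∃ X, n ≤ F X := by
  rcases n with _ | n
  · exact ⟨∅, Nat.zero_le _⟩
  let σ : Finset ℤ → ZMod 2 := fun X => if F (-X) < F X then 1 else 0
  have hσ : ∀ X, IsSigned (n + 1) X → X.Nonempty → σ (-X) = σ X + 1 := by
    intro X hX hX'
    have h := hne X hX hX'
    have h11 : (1 : ZMod 2) + 1 = 0 := by decide
    simp only [σ, neg_neg]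
    rcases lt_or_gt_of_ne h with h | h
    · simp [h, h.not_gt]
    · simp [h, h.not_gt, h11]
  have chain : ∀ d X, IsSigned (n + 1) X → X.card = d + 1 → altChains σ d X ≠ 0 →
      d + 1 ≤ max (F X) (F (-X)) := by
    intro d
    induction d with
    | zero =>
      intro X hX hc _
      have := hne X hX (Finset.card_pos.1 (by omega))
      omega
    | succ d ih =>
      intro X hX hc h
      obtain ⟨a, ha, hne0⟩ := Finset.exists_ne_zero_of_sum_ne_zero h
      have hs : IsSigned (n + 1) (X.erase a) := hX.subset (Finset.erase_subset _ _)
      have hc' : (X.erase a).card = d + 1 := by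
        rw [Finset.card_erase_of_mem ha, hc]
        rfl
      have hle := ih _ hs hc' (right_ne_zero_of_mul hne0)
      have hsg : σ (X.erase a) ≠ σ X := fun heq =>
        left_ne_zero_of_mul hne0 (by rw [heq]; exact CharTwo.add_self_eq_zero _)
      have m1 : F (X.erase a) ≤ F X := hF (Finset.erase_subset _ _)
      have m2 : F (-(X.erase a)) ≤ F (-X) := hF (Finset.neg_subset_neg (Finset.erase_subset _ _))
      have n1 := hne X hX (Finset.card_pos.1 (by omega))
      have n2 := hne _ hs (Finset.card_pos.1 (by omega))
      simp only [σ] at hsg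
      split_ifs at hsg
      all_goals first | exact absurd rfl hsg | omega
  by_contra! hlt
  have h0 : signSum n (fun X => altChains σ n (insert ((n : ℤ) + 1) X)) =
      signSum n (fun _ => 0) := by
    refine signSum_congr _ _ _ fun X hX => ?_
    have hX' := hX.insert (a := (n : ℤ) + 1) (by omega)
    by_contra h
    have := chain n _ hX'.1 hX'.2 h
    have := hlt (insert ((n : ℤ) + 1) X)
    have := hlt (-(insert ((n : ℤ) + 1) X))
    omega
  rw [signSum_altChains σ hσ n n.lt_succ_self, signSum_zero] at h0
  exact one_ne_zero h0

/-- The length of a longest alternating subsequence, ending in a positive entry, of the sign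
vector `X` restricted to `{1, …, n}`. -/
def altLength : ℕ → Finset ℤ → ℕ
  | 0, _ => 0
  | n + 1, X =>
    if (n : ℤ) + 1 ∈ X then max (altLength n X) (altLength n (-X) + 1) else altLength n X

lemma altLength_mono (n : ℕ) : Monotone (altLength n) := by
  induction n with
  | zero => exact fun _ _ _ => le_rfl
  | succ n ih =>
    intro X Y h
    have h1 := ih h
    have h2 := ih (Finset.neg_subset_neg h)
    simp only [altLength]
    split_ifs with hX hY hY
    · exact max_le_max h1 (Nat.succ_le_succ h2)
    · exact absurd (h hX) hY
    · exact h1.trans (le_max_left _ _)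
    · exact h1

lemma altLength_neg_cases (n : ℕ) (X : Finset ℤ) (hX : ∀ a ∈ X, -a ∉ X) :
    (altLength n X = altLength n (-X) + 1 ∨ altLength n (-X) = altLength n X + 1) ∨
      (altLength n X = altLength n (-X) ∧ ∀ a ∈ X, n < a.natAbs) := by
  induction n with
  | zero =>
    refine .inr ⟨rfl, fun a ha => Int.natAbs_pos.2 ?_⟩
    rintro rfl
    exact hX 0 ha ha
  | succ n ih =>
    simp only [altLength, neg_neg, Finset.mem_neg']
    by_cases h1 : (n : ℤ) + 1 ∈ X
    · have h2 := hX _ h1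
      rw [if_pos h1, if_neg h2]
      omega
    · by_cases h2 : -((n : ℤ) + 1) ∈ X
      · rw [if_neg h1, if_pos h2]
        omega
      · rw [if_neg h1, if_neg h2]
        refine ih.imp id fun h => ⟨h.1, fun a ha => ?_⟩
        have h3 := h.2 a ha
        have h4 : a ≠ (n : ℤ) + 1 := fun h => h1 (h ▸ ha)
        have h5 : a ≠ -((n : ℤ) + 1) := fun h => h2 (h ▸ ha)
        omega

lemma exists_interlacing_of_le_altLength (n m : ℕ) (X : Finset ℤ) (h : m ≤ altLength n X) :
    ∃ S T : Finset ℕ, S ⊆ Icc 1 n ∧ T ⊆ Icc 1 n ∧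
      (∀ i ∈ S, (i : ℤ) ∈ X) ∧ (∀ i ∈ T, -(i : ℤ) ∈ X) ∧
      S.card = (m + 1) / 2 ∧ T.card = m / 2 ∧
      (∀ i ∈ S, i + 1 ∉ S) ∧ (∀ i ∈ T, i + 1 ∉ T) ∧
      (m % 2 = 0 → 1 ∉ S) ∧ (m % 2 = 1 → 1 ∉ T) ∧ n ∉ T := by
  induction n generalizing m X with
  | zero =>
    obtain rfl : m = 0 := Nat.le_zero.1 h
    exact ⟨∅, ∅, by simp⟩
  | succ n ih =>
    have skip : m ≤ altLength n X → ∃ S T : Finset ℕ, S ⊆ Icc 1 (n + 1) ∧ T ⊆ Icc 1 (n + 1) ∧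
        (∀ i ∈ S, (i : ℤ) ∈ X) ∧ (∀ i ∈ T, -(i : ℤ) ∈ X) ∧
        S.card = (m + 1) / 2 ∧ T.card = m / 2 ∧
        (∀ i ∈ S, i + 1 ∉ S) ∧ (∀ i ∈ T, i + 1 ∉ T) ∧
        (m % 2 = 0 → 1 ∉ S) ∧ (m % 2 = 1 → 1 ∉ T) ∧ n + 1 ∉ T := by
      intro h
      obtain ⟨S, T, hS, hT, h1, h2, h3, h4, h5, h6, h7, h8, _⟩ := ih m X h
      have hI : Icc 1 n ⊆ Icc 1 (n + 1) := Finset.Icc_subset_Icc_right (Nat.le_succ n)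
      refine ⟨S, T, hS.trans hI, hT.trans hI, h1, h2, h3, h4, h5, h6, h7, h8, fun hm => ?_⟩
      have := Finset.mem_Icc.1 (hT hm)
      omega
    simp only [altLength] at h
    split_ifs at h with hX
    · rcases le_max_iff.1 h with h | h
      · exact skip h
      rcases m with _ | m
      · exact skip (Nat.zero_le _)
      obtain ⟨S, T, hS, hT, h1, h2, h3, h4, h5, h6, h7, h8, h9⟩ :=
        ih m (-X) (Nat.le_of_succ_le_succ h)
      have hSb : ∀ i ∈ S, 1 ≤ i ∧ i ≤ n := fun i hi => Finset.mem_Icc.1 (hS hi)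
      have hTb : ∀ i ∈ T, 1 ≤ i ∧ i ≤ n := fun i hi => Finset.mem_Icc.1 (hT hi)
      have hnT : n + 1 ∉ T := fun hm => by
        have := hTb _ hm
        omega
      refine ⟨insert (n + 1) T, S, ?_, ?_, ?_, ?_, ?_, ?_, ?_, h5, ?_, ?_, ?_⟩
      · intro i hi
        rw [Finset.mem_Icc]
        rcases Finset.mem_insert.1 hi with rfl | hi
        · omega
        · have := hTb i hi
          omega
      · intro i hi
        rw [Finset.mem_Icc]
        have := hSb i hi
        omega
      · intro i hi
        rcases Finset.mem_insert.1 hi with rfl | hi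
        · exact_mod_cast hX
        · simpa [Finset.mem_neg'] using h2 i hi
      · intro i hi
        simpa [Finset.mem_neg'] using h1 i hi
      · rw [Finset.card_insert_of_notMem hnT]
        omega
      · omega
      · intro i hi hi'
        rw [Finset.mem_insert] at hi hi'
        rcases hi with rfl | hi <;> rcases hi' with hi' | hi'
        · omega
        · have := hTb _ hi'
          omega
        · obtain rfl : i = n := by omega
          exact h9 hi
        · exact h6 i hi hi'
      · intro hm h1'
        rcases Finset.mem_insert.1 h1' with h1' | h1'
        · obtain rfl : n = 0 := by omega
          obtain rfl : S = ∅ := by simpa using hS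
          simp only [Finset.card_empty] at h3
          omega
        · exact h8 (by omega) h1'
      · exact fun hm => h7 (by omega)
      · intro hm
        have := hSb _ hm
        omega
    · exact skip h

open Classical in
/-- The stable `k`-subsets of `{1, …, n}` contained in the positive part of `X`. -/
noncomputable def stableSubsets (n k : ℕ) (X : Finset ℤ) : Finset (Finset ℕ) :=
  {S ∈ (Icc 1 n).powersetCard k | IsStableSet n S ∧ ∀ i ∈ S, (i : ℤ) ∈ X}

lemma mem_stableSubsets {n k : ℕ} {X : Finset ℤ} {S : Finset ℕ} :
    S ∈ stableSubsets n k X ↔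
      (S ⊆ Icc 1 n ∧ S.card = k) ∧ IsStableSet n S ∧ ∀ i ∈ S, (i : ℤ) ∈ X := by
  simp [stableSubsets, Finset.mem_powersetCard]

lemma stableSubsets_mono (n k : ℕ) : Monotone (stableSubsets n k) := by
  intro X Y h S hS
  rw [mem_stableSubsets] at hS ⊢
  exact ⟨hS.1, hS.2.1, fun i hi => h (hS.2.2 i hi)⟩

lemma stableSubsets_nonempty_of_le_altLength {n k : ℕ} {X : Finset ℤ}
    (h : 2 * k ≤ altLength n X) :
    (stableSubsets n k X).Nonempty ∧ (stableSubsets n k (-X)).Nonempty := by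
  obtain ⟨S, T, hS, hT, h1, h2, h3, h4, h5, h6, h7, -, h9⟩ :=
    exists_interlacing_of_le_altLength n (2 * k) X h
  refine ⟨⟨S, mem_stableSubsets.2 ⟨⟨hS, by omega⟩, ⟨fun i hi _ => h5 i hi, ?_⟩, h1⟩⟩,
    ⟨T, mem_stableSubsets.2 ⟨⟨hT, by omega⟩, ⟨fun i hi _ => h6 i hi, ?_⟩, ?_⟩⟩⟩
  · exact fun h => h7 (by omega) h.2
  · exact fun h => h9 h.1
  · exact fun i hi => Finset.mem_neg'.2 (h2 i hi)

theorem schrijver_monochromatic_edge (n k : ℕ) (hk : 1 ≤ k) (hn : 2 * k ≤ n)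
    (c : Finset ℕ → Fin (n - 2 * k + 1)) :
    ∃ S₁ S₂ : Finset ℕ,
      S₁ ⊆ Finset.Icc 1 n ∧ S₁.card = k ∧ IsStableSet n S₁ ∧
      S₂ ⊆ Finset.Icc 1 n ∧ S₂.card = k ∧ IsStableSet n S₂ ∧
      Disjoint S₁ S₂ ∧ c S₁ = c S₂ := by
  by_contra hcon
  let g : Finset ℤ → ℕ := fun X => (stableSubsets n k X).sup fun S => (c S : ℕ)
  have hg : Monotone g := fun X Y h => Finset.sup_mono (stableSubsets_mono n k h)
  have hg_le : ∀ X, g X ≤ n - 2 * k := fun X =>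
    Finset.sup_le fun S _ => Nat.le_of_lt_succ (c S).2
  let F : Finset ℤ → ℕ := fun X =>
    if altLength n X < 2 * k ∧ altLength n (-X) < 2 * k then altLength n X
    else 2 * k - 1 + g X
  have hF : Monotone F := by
    intro X Y h
    have h1 := altLength_mono n h
    have h2 := altLength_mono n (Finset.neg_subset_neg h)
    have h3 := hg h
    simp only [F]
    split_ifs <;> omega
  have hne : ∀ X, IsSigned n X → X.Nonempty → F X ≠ F (-X) := by
    intro X hX ⟨a, ha⟩
    have hcases := altLength_neg_cases n X fun b hb => (hX b hb).1
    have hfar : ¬ ∀ b ∈ X, n < b.natAbs := fun h => (h a ha).not_ge (hX a ha).2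
    simp only [F, neg_neg]
    by_cases hlow : altLength n X < 2 * k ∧ altLength n (-X) < 2 * k
    · rw [if_pos hlow, if_pos hlow.symm]
      rcases hcases with h | h
      · omega
      · exact absurd h.2 hfar
    rw [if_neg hlow, if_neg fun h => hlow h.symm]
    have hnonempty : (stableSubsets n k X).Nonempty ∧ (stableSubsets n k (-X)).Nonempty := by
      by_cases h : 2 * k ≤ altLength n X
      · exact stableSubsets_nonempty_of_le_altLength h
      · have h' := stableSubsets_nonempty_of_le_altLength (n := n) (k := k) (X := -X) (by omega)
        rw [neg_neg] at h'
        exact h'.symm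
    obtain ⟨S, hS, hgS⟩ := Finset.exists_mem_eq_sup _ hnonempty.1 fun S => (c S : ℕ)
    obtain ⟨T, hT, hgT⟩ := Finset.exists_mem_eq_sup _ hnonempty.2 fun S => (c S : ℕ)
    intro heq
    rw [mem_stableSubsets] at hS hT
    refine hcon ⟨S, T, hS.1.1, hS.1.2, hS.2.1, hT.1.1, hT.1.2, hT.2.1, ?_, Fin.ext ?_⟩
    · rw [Finset.disjoint_left]
      exact fun i hi hi' => (hX i (hS.2.2 i hi)).1 (Finset.mem_neg'.1 (hT.2.2 i hi'))
    · rw [← hgS, ← hgT]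
      exact Nat.add_left_cancel heq
  obtain ⟨X, hX⟩ := exists_le_of_monotone_of_ne_neg n F hF hne
  have := hg_le X
  simp only [F] at hX
  split_ifs at hX <;> omega
end
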